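/- arXiv:2204.11805 — 2 statements merged into one kernel-verified Lean document; each statement's English description precedes it below -/
import Mathlib

section
/- The set of P-positions (x,y) of the 2-Queen Dee game with x ≤ y is exactly {(a_n, b_n) : n ∈ ℕ}; in other words, the P-positions of Corner the 2-Queen Dee, listed by increasing first coordinate, satisfy a_{n+1} = mex({a_i, b_i : i ≤ n}) and b_{n+1} − a_{n+1} = mex₂({b_i − a_i, b_i + a_i : i ≤ n}). -/
/-- A legal move of the 2-Queen Dee from `p` to `q`: the Manhattan distance decreases,
and the move is within a column or row, a diagonal move possibly preceded by a single
one-step sidestep, or such a diagonal move reflecting off a side of the board and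
continuing anti-diagonally. -/
def QDeeMove (p q : ℕ × ℕ) : Prop :=
  q.1 + q.2 < p.1 + p.2 ∧
    (q.1 = p.1 ∨ q.2 = p.2 ∨
      |((q.2 : ℤ) - q.1) - ((p.2 : ℤ) - p.1)| ≤ 1 ∨
      |((q.1 : ℤ) + q.2) - abs ((p.2 : ℤ) - p.1)| ≤ 1)

/-- P-positions of the 2-Queen Dee game, defined by well-founded recursion on `x + y`:
a position is a P-position iff every legal move from it leads to a non-P-position. -/
def QDeePPos (p : ℕ × ℕ) : Prop :=
  ∀ q, QDeeMove p q → ¬ QDeePPos q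
termination_by p.1 + p.2
decreasing_by exact ‹QDeeMove p q›.1

/-- `mex S` : the least natural number not in `S`. -/
noncomputable def mex (S : Set ℕ) : ℕ := sInf {m : ℕ | m ∉ S}

/-- `mex₂ S` : the least positive even integer not in `S`. -/
noncomputable def mex₂ (S : Set ℕ) : ℕ := sInf {m : ℕ | 0 < m ∧ Even m ∧ m ∉ S}

/-- The sequence of pairs `(aₙ, bₙ)`: `(a₀,b₀) = (0,0)`,
`a_{n+1} = mex({aᵢ : i ≤ n} ∪ {bᵢ : i ≤ n})` and
`b_{n+1} = a_{n+1} + mex₂({bᵢ − aᵢ : i ≤ n} ∪ {bᵢ + aᵢ : i ≤ n})`. -/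
noncomputable def qdee : ℕ → ℕ × ℕ
  | 0 => (0, 0)
  | n + 1 =>
      let A : ℕ := mex ({m | ∃ i, ∃ _ : i ≤ n, m = (qdee i).1} ∪
        {m | ∃ i, ∃ _ : i ≤ n, m = (qdee i).2})
      let D : ℕ := mex₂ ({m | ∃ i, ∃ _ : i ≤ n, m = (qdee i).2 - (qdee i).1} ∪
        {m | ∃ i, ∃ _ : i ≤ n, m = (qdee i).2 + (qdee i).1})
      (A, A + D)
termination_by n => n
decreasing_by all_goals omega

theorem finite_setOf_exists_le_eq (f : ℕ → ℕ) (n : ℕ) :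
    {m | ∃ i, ∃ _ : i ≤ n, m = f i}.Finite :=
  ((Set.finite_Iic n).image f).subset (by
    rintro m ⟨i, hi, rfl⟩
    exact ⟨i, hi, rfl⟩)

theorem mex_notMem {S : Set ℕ} (hS : S.Finite) : mex S ∉ S :=
  Nat.sInf_mem (s := {m | m ∉ S}) hS.exists_notMem

theorem mem_of_lt_mex {S : Set ℕ} {k : ℕ} (hk : k < mex S) : k ∈ S :=
  not_not.1 (Nat.notMem_of_lt_sInf (s := {m | m ∉ S}) hk)

theorem mex₂_spec {S : Set ℕ} (hS : S.Finite) : 0 < mex₂ S ∧ Even (mex₂ S) ∧ mex₂ S ∉ S := by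
  refine Nat.sInf_mem (s := {m | 0 < m ∧ Even m ∧ m ∉ S}) ?_
  obtain ⟨B, hB⟩ := hS.bddAbove
  refine ⟨2 * (B + 1), by omega, even_two_mul _, fun h => ?_⟩
  have := hB h
  omega

theorem mem_of_lt_mex₂ {S : Set ℕ} {k : ℕ} (hk : k < mex₂ S) (hpos : 0 < k) (heven : Even k) :
    k ∈ S := by
  by_contra h
  exact Nat.notMem_of_lt_sInf (s := {m | 0 < m ∧ Even m ∧ m ∉ S}) hk ⟨hpos, heven, h⟩

/-- The difference `bₙ - aₙ`. -/
noncomputable def qdeeDiff (n : ℕ) : ℕ := (qdee n).2 - (qdee n).1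

theorem qdee_succ_fst (n : ℕ) : (qdee (n + 1)).1 =
    mex ({m | ∃ i, ∃ _ : i ≤ n, m = (qdee i).1} ∪ {m | ∃ i, ∃ _ : i ≤ n, m = (qdee i).2}) := by
  rw [qdee]

theorem qdee_succ_snd (n : ℕ) : (qdee (n + 1)).2 = (qdee (n + 1)).1 +
    mex₂ ({m | ∃ i, ∃ _ : i ≤ n, m = (qdee i).2 - (qdee i).1} ∪
      {m | ∃ i, ∃ _ : i ≤ n, m = (qdee i).2 + (qdee i).1}) := by
  rw [qdee]

theorem qdee_zero : qdee 0 = (0, 0) := by rw [qdee]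

theorem qdeeDiff_zero : qdeeDiff 0 = 0 := by simp [qdeeDiff, qdee_zero]

theorem qdeeDiff_succ (n : ℕ) : qdeeDiff (n + 1) =
    mex₂ ({m | ∃ i, ∃ _ : i ≤ n, m = (qdee i).2 - (qdee i).1} ∪
      {m | ∃ i, ∃ _ : i ≤ n, m = (qdee i).2 + (qdee i).1}) := by
  rw [qdeeDiff, qdee_succ_snd, Nat.add_sub_cancel_left]

theorem qdee_snd (n : ℕ) : (qdee n).2 = (qdee n).1 + qdeeDiff n := by
  cases n with
  | zero => simp [qdeeDiff, qdee_zero]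
  | succ n => rw [qdeeDiff_succ, ← qdee_succ_snd]

theorem qdee_fst_ne {i n : ℕ} (h : i < n) :
    (qdee n).1 ≠ (qdee i).1 ∧ (qdee n).1 ≠ (qdee i).2 := by
  obtain ⟨n, rfl⟩ := Nat.exists_eq_succ_of_ne_zero (Nat.ne_zero_of_lt h)
  have := mex_notMem ((finite_setOf_exists_le_eq (fun i => (qdee i).1) n).union
    (finite_setOf_exists_le_eq (fun i => (qdee i).2) n))
  rw [← qdee_succ_fst] at this
  exact ⟨fun e => this (Or.inl ⟨i, Nat.le_of_lt_succ h, e⟩),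
    fun e => this (Or.inr ⟨i, Nat.le_of_lt_succ h, e⟩)⟩

theorem exists_eq_of_lt_qdee_fst {k n : ℕ} (h : k < (qdee n).1) :
    ∃ i < n, k = (qdee i).1 ∨ k = (qdee i).2 := by
  cases n with
  | zero => simp [qdee_zero] at h
  | succ n =>
    rw [qdee_succ_fst] at h
    rcases mem_of_lt_mex h with ⟨i, hi, e⟩ | ⟨i, hi, e⟩
    exacts [⟨i, Nat.lt_succ_of_le hi, Or.inl e⟩, ⟨i, Nat.lt_succ_of_le hi, Or.inr e⟩]

theorem qdeeDiff_succ_spec (n : ℕ) : 0 < qdeeDiff (n + 1) ∧ Even (qdeeDiff (n + 1)) ∧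
    ∀ i ≤ n, qdeeDiff (n + 1) ≠ qdeeDiff i ∧ qdeeDiff (n + 1) ≠ (qdee i).2 + (qdee i).1 := by
  have := mex₂_spec ((finite_setOf_exists_le_eq (fun i => (qdee i).2 - (qdee i).1) n).union
    (finite_setOf_exists_le_eq (fun i => (qdee i).2 + (qdee i).1) n))
  rw [← qdeeDiff_succ] at this
  exact ⟨this.1, this.2.1, fun i hi => ⟨fun e => this.2.2 (Or.inl ⟨i, hi, e⟩),
    fun e => this.2.2 (Or.inr ⟨i, hi, e⟩)⟩⟩

theorem even_qdeeDiff (n : ℕ) : Even (qdeeDiff n) := by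
  cases n with
  | zero => simp [qdeeDiff_zero]
  | succ n => exact (qdeeDiff_succ_spec n).2.1

theorem qdeeDiff_ne {i n : ℕ} (h : i < n) :
    0 < qdeeDiff n ∧ qdeeDiff n ≠ qdeeDiff i ∧ qdeeDiff n ≠ (qdee i).2 + (qdee i).1 := by
  obtain ⟨n, rfl⟩ := Nat.exists_eq_succ_of_ne_zero (Nat.ne_zero_of_lt h)
  have := qdeeDiff_succ_spec n
  exact ⟨this.1, this.2.2 i (Nat.le_of_lt_succ h)⟩

theorem exists_eq_of_lt_qdeeDiff {k n : ℕ} (h : k < qdeeDiff n) (heven : Even k) :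
    ∃ i < n, k = qdeeDiff i ∨ k = (qdee i).2 + (qdee i).1 := by
  cases n with
  | zero => simp [qdeeDiff_zero] at h
  | succ n =>
    rcases k.eq_zero_or_pos with rfl | hpos
    · exact ⟨0, n.succ_pos, Or.inl qdeeDiff_zero.symm⟩
    rw [qdeeDiff_succ] at h
    rcases mem_of_lt_mex₂ h hpos heven with ⟨i, hi, e⟩ | ⟨i, hi, e⟩
    exacts [⟨i, Nat.lt_succ_of_le hi, Or.inl e⟩, ⟨i, Nat.lt_succ_of_le hi, Or.inr e⟩]

theorem strictMono_qdee_fst : StrictMono fun n => (qdee n).1 := by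
  intro m n h
  refine lt_of_le_of_ne (not_lt.1 fun hlt => ?_) (qdee_fst_ne h).1.symm
  obtain ⟨i, hi, e | e⟩ := exists_eq_of_lt_qdee_fst hlt
  exacts [(qdee_fst_ne (hi.trans h)).1 e, (qdee_fst_ne (hi.trans h)).2 e]

theorem strictMono_qdeeDiff : StrictMono qdeeDiff := by
  intro m n h
  refine lt_of_le_of_ne (not_lt.1 fun hlt => ?_) (qdeeDiff_ne h).2.1.symm
  obtain ⟨i, hi, e | e⟩ := exists_eq_of_lt_qdeeDiff hlt (even_qdeeDiff n)
  exacts [(qdeeDiff_ne (hi.trans h)).2.1 e, (qdeeDiff_ne (hi.trans h)).2.2 e]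

theorem exists_eq_qdee_fst_or_snd (k : ℕ) : ∃ n, k = (qdee n).1 ∨ k = (qdee n).2 := by
  have h : k < (qdee (k + 1)).1 := strictMono_qdee_fst.le_apply (x := k + 1)
  obtain ⟨i, -, e⟩ := exists_eq_of_lt_qdee_fst h
  exact ⟨i, e⟩

/-- A position lying, up to reflection, on the sequence of pairs `(aₙ, bₙ)`. -/
def OnQDee (p : ℕ × ℕ) : Prop := ∃ n, p = qdee n ∨ p.swap = qdee n

theorem QDeeMove.swap {p q : ℕ × ℕ} (h : QDeeMove p q) : QDeeMove p.swap q.swap := by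
  simp only [QDeeMove, Prod.fst_swap, Prod.snd_swap] at h ⊢
  grind

theorem OnQDee.swap {p : ℕ × ℕ} (h : OnQDee p) : OnQDee p.swap := by
  obtain ⟨n, h | h⟩ := h
  exacts [⟨n, Or.inr h⟩, ⟨n, Or.inl h⟩]

theorem not_onQDee_of_move_qdee {n : ℕ} {q : ℕ × ℕ} (h : QDeeMove (qdee n) q) : ¬ OnQDee q := by
  rintro ⟨m, hm⟩
  have hq : (q.1 = (qdee m).1 ∧ q.2 = (qdee m).2) ∨ (q.1 = (qdee m).2 ∧ q.2 = (qdee m).1) := by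
    rcases hm with rfl | hm
    · simp
    · simp [← hm]
  obtain ⟨hlt, h⟩ := h
  have hbm := qdee_snd m
  have hbn := qdee_snd n
  have hmn : m < n := by
    by_contra! hle
    have := strictMono_qdee_fst.monotone hle
    have := strictMono_qdeeDiff.monotone hle
    grind
  have := strictMono_qdee_fst hmn
  have := strictMono_qdeeDiff hmn
  have := qdee_fst_ne hmn
  have := qdeeDiff_ne hmn
  obtain ⟨r, hr⟩ := even_qdeeDiff m
  obtain ⟨s, hs⟩ := even_qdeeDiff n
  rcases h with h | h | h | h
  · omega
  · omega
  · rw [abs_le] at h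
    omega
  · rw [abs_of_nonneg (by omega : (0 : ℤ) ≤ (qdee n).2 - (qdee n).1), abs_le] at h
    omega

theorem not_onQDee_of_move {p q : ℕ × ℕ} (hp : OnQDee p) (h : QDeeMove p q) : ¬ OnQDee q := by
  obtain ⟨n, hn | hn⟩ := hp
  · exact not_onQDee_of_move_qdee (hn ▸ h)
  · exact fun hq => not_onQDee_of_move_qdee (hn ▸ h.swap) hq.swap

theorem exists_move_onQDee_of_le {x y : ℕ} (hxy : x ≤ y) (hp : ¬ OnQDee (x, y)) :
    ∃ q, QDeeMove (x, y) q ∧ OnQDee q := by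
  obtain ⟨n, rfl | rfl⟩ := exists_eq_qdee_fst_or_snd x
  · have hb := qdee_snd n
    rcases lt_trichotomy y (qdee n).2 with hy | rfl | hy
    · obtain ⟨k, hk, hke⟩ : ∃ k, Even k ∧
          (k + (qdee n).1 = y ∨ k + 1 + (qdee n).1 = y) := by
        rcases Nat.even_or_odd' (y - (qdee n).1) with ⟨c, hc | hc⟩
        · exact ⟨2 * c, even_two_mul c, by omega⟩
        · exact ⟨2 * c, even_two_mul c, by omega⟩
      obtain ⟨i, hi, e⟩ := exists_eq_of_lt_qdeeDiff (n := n) (by omega) hk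
      have hlt := strictMono_qdee_fst hi
      have hbi := qdee_snd i
      refine ⟨qdee i, ⟨?_, ?_⟩, i, Or.inl rfl⟩
      · dsimp only at hlt ⊢
        omega
      · right; right
        dsimp only
        rw [abs_of_nonneg (by omega : (0 : ℤ) ≤ y - (qdee n).1), abs_le, abs_le]
        omega
    · exact (hp ⟨n, Or.inl rfl⟩).elim
    · exact ⟨qdee n, ⟨by dsimp only; omega, Or.inl rfl⟩, n, Or.inl rfl⟩
  · rcases hxy.eq_or_lt with rfl | hlt
    · by_cases h0 : (qdee n).2 = 0
      · exact (hp ⟨0, Or.inl (by rw [qdee_zero, h0])⟩).elim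
      · exact ⟨qdee 0, by simp [QDeeMove, qdee_zero]; omega, 0, Or.inl rfl⟩
    · exact ⟨(qdee n).swap, ⟨by have := qdee_snd n; simp; omega, Or.inl rfl⟩, n, Or.inr rfl⟩

theorem exists_move_onQDee {p : ℕ × ℕ} (hp : ¬ OnQDee p) : ∃ q, QDeeMove p q ∧ OnQDee q := by
  rcases le_total p.1 p.2 with h | h
  · exact exists_move_onQDee_of_le h hp
  · obtain ⟨q, hq, hT⟩ := exists_move_onQDee_of_le (x := p.2) (y := p.1) h fun h => hp h.swap
    exact ⟨q.swap, hq.swap, hT.swap⟩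

theorem qdeePPos_iff_onQDee (p : ℕ × ℕ) : QDeePPos p ↔ OnQDee p := by
  induction hs : p.1 + p.2 using Nat.strong_induction_on generalizing p with
  | _ s ih =>
    have ih' : ∀ q, QDeeMove p q → (QDeePPos q ↔ OnQDee q) := fun q hq =>
      ih _ (hs ▸ hq.1) q rfl
    rw [QDeePPos]
    refine ⟨fun h => ?_, fun h q hq => (ih' q hq).not.2 (not_onQDee_of_move h hq)⟩
    by_contra hp
    obtain ⟨q, hq, hT⟩ := exists_move_onQDee hp
    exact h q hq ((ih' q hq).2 hT)

/-- The set of P-positions `(x,y)` of the 2-Queen Dee game with `x ≤ y` is exactly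
`{(aₙ,bₙ) : n ∈ ℕ}`; i.e. the P-positions of Corner the 2-Queen Dee, listed by
increasing first coordinate, satisfy `a_{n+1} = mex({aᵢ,bᵢ : i ≤ n})` and
`b_{n+1} − a_{n+1} = mex₂({bᵢ−aᵢ, bᵢ+aᵢ : i ≤ n})`. -/
theorem qdee_ppositions (x y : ℕ) (hxy : x ≤ y) :
    QDeePPos (x, y) ↔ ∃ n, (x, y) = qdee n := by
  rw [qdeePPos_iff_onQDee]
  refine ⟨?_, fun ⟨n, h⟩ => ⟨n, Or.inl h⟩⟩
  rintro ⟨n, h | h⟩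
  · exact ⟨n, h⟩
  · have hb := qdee_snd n
    rw [← h] at hb
    simp only [Prod.fst_swap, Prod.snd_swap] at hb
    obtain rfl : x = y := by omega
    exact ⟨n, h⟩
end

section
/- For every n ≥ 1, either α_{β_n} = α_n + β_n or α_{β_n} = α_n + β_n − 1. (The coordinate sums of the P-positions of Corner the Queen Dee satisfy Equation (1) of the paper.) -/
/-- The P-positions `(αₙ, βₙ)` of Corner the Queen Dee: `(α₀,β₀) = (0,0)`,
`α_{n+1} = mex({αᵢ : i ≤ n} ∪ {βᵢ : i ≤ n})` and
`β_{n+1} = α_{n+1} + mex({βᵢ − αᵢ : i ≤ n} ∪ {βᵢ + αᵢ : i ≤ n})`. -/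
noncomputable def qdee1 : ℕ → ℕ × ℕ
  | 0 => (0, 0)
  | n + 1 =>
      let A : ℕ := mex ({m | ∃ i, ∃ _ : i ≤ n, m = (qdee1 i).1} ∪
        {m | ∃ i, ∃ _ : i ≤ n, m = (qdee1 i).2})
      let D : ℕ := mex ({m | ∃ i, ∃ _ : i ≤ n, m = (qdee1 i).2 - (qdee1 i).1} ∪
        {m | ∃ i, ∃ _ : i ≤ n, m = (qdee1 i).2 + (qdee1 i).1})
      (A, A + D)
termination_by n => n
decreasing_by all_goals omega

/-- The successor of a numeral in the Tribonacci numeration system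
(binary digits, least significant first, without three consecutive ones). -/
def tribSucc : List Bool → List Bool
  | [] => [true]
  | true :: w => false :: tribSucc w
  | false :: w =>
      if (w.takeWhile id).length < 2 then true :: w else false :: tribSucc w

/-- The Tribonacci numeral of `n`. -/
def tribRep : ℕ → List Bool
  | 0 => []
  | n + 1 => tribSucc (tribRep n)

/-- The Tribonacci word `0102010…`, the fixed point of `0 ↦ 01`, `1 ↦ 02`, `2 ↦ 0`. -/
def trib (n : ℕ) : ℕ := ((tribRep n).takeWhile id).length

/-- The number of letters `i` among the first `n` letters of the Tribonacci word. -/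
def tribCount (i n : ℕ) : ℕ := n.count (fun m => trib m = i)

/-- The position of the `n`-th letter `0` (counting from zero) of the Tribonacci word. -/
def tribPos (n : ℕ) : ℕ := n + tribCount 0 n + tribCount 1 n

theorem tribCount_zero (i : ℕ) : tribCount i 0 = 0 := by simp [tribCount]

theorem tribCount_succ (i n : ℕ) :
    tribCount i (n + 1) = tribCount i n + if trib n = i then 1 else 0 := by
  simp [tribCount, Nat.count_succ]

theorem trib_le_two (n : ℕ) : trib n ≤ 2 := by
  cases n with
  | zero => simp [trib, tribRep]
  | succ n =>
    unfold trib
    rw [tribRep]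
    rcases tribRep n with _ | ⟨_ | _, w⟩
    · simp [tribSucc]
    · rw [tribSucc]
      split_ifs with h
      · simp only [List.takeWhile_cons, id, if_true, List.length_cons]
        omega
      · simp
    · simp [tribSucc]

theorem tribSucc_ne_nil (w : List Bool) : tribSucc w ≠ [] := by
  rcases w with _ | ⟨_ | _, w⟩
  · simp [tribSucc]
  · rw [tribSucc]
    split_ifs <;> simp
  · simp [tribSucc]

theorem tribSucc_ite {w : List Bool} (h : (w.takeWhile id).length < 2) :
    tribSucc (if w = [] then [] else false :: w) = true :: w := by
  split_ifs with hw
  · rw [hw, tribSucc]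
  · exact if_pos h

/-- Prepending the digit `0` to the numeral of `n` gives the numeral of `tribPos n`, stated together
with the letter counts of the prefix of length `tribPos n`. -/
theorem tribRep_tribPos (n : ℕ) :
    tribRep (tribPos n) = (if tribRep n = [] then [] else false :: tribRep n) ∧
      tribCount 0 (tribPos n) = n ∧ tribCount 1 (tribPos n) = tribCount 0 n := by
  induction n with
  | zero => simp [tribPos, tribCount_zero, tribRep]
  | succ n ih =>
    obtain ⟨h, h0, h1⟩ := ih
    have hz : trib (tribPos n) = 0 := by
      unfold trib
      rw [h]
      split_ifs <;> simp
    have hne : tribRep (n + 1) ≠ [] := tribSucc_ne_nil _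
    rw [if_neg hne]
    have c0 := tribCount_succ 0 n
    have c1 := tribCount_succ 1 n
    have d0 := tribCount_succ 0 (tribPos n)
    have d1 := tribCount_succ 1 (tribPos n)
    by_cases ht : trib n < 2
    · have hr : tribRep (tribPos n + 1) = true :: tribRep n := by
        rw [tribRep, h, tribSucc_ite ht]
      have hl : trib (tribPos n + 1) = trib n + 1 := by
        unfold trib
        rw [hr]
        simp
      have hp : tribPos (n + 1) = tribPos n + 1 + 1 := by
        unfold tribPos
        split_ifs at c0 c1 <;> omega
      have e0 := tribCount_succ 0 (tribPos n + 1)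
      have e1 := tribCount_succ 1 (tribPos n + 1)
      rw [hp]
      refine ⟨by rw [tribRep, hr]; rfl, ?_, ?_⟩ <;>
      split_ifs at * <;> omega
    · have hp : tribPos (n + 1) = tribPos n + 1 := by
        unfold tribPos
        split_ifs at c0 c1 <;> omega
      rw [hp]
      refine ⟨?_, ?_, ?_⟩
      · rw [tribRep, h]
        split_ifs with hn
        · simp [trib, hn] at ht
        · exact if_neg ht
      all_goals split_ifs at * <;> omega

theorem tribCount_zero_tribPos (n : ℕ) : tribCount 0 (tribPos n) = n := (tribRep_tribPos n).2.1

theorem tribCount_one_tribPos (n : ℕ) : tribCount 1 (tribPos n) = tribCount 0 n :=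
  (tribRep_tribPos n).2.2

theorem trib_tribPos (n : ℕ) : trib (tribPos n) = 0 := by
  unfold trib
  rw [(tribRep_tribPos n).1]
  split_ifs <;> simp

theorem trib_tribPos_add_one {n : ℕ} (h : trib n < 2) : trib (tribPos n + 1) = trib n + 1 := by
  have hr : tribRep (tribPos n + 1) = true :: tribRep n := by
    rw [tribRep, (tribRep_tribPos n).1, tribSucc_ite h]
  unfold trib
  rw [hr]
  simp

theorem tribPos_succ (n : ℕ) : tribPos (n + 1) = tribPos n + if trib n = 2 then 1 else 2 := by
  have c0 := tribCount_succ 0 n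
  have c1 := tribCount_succ 1 n
  have := trib_le_two n
  unfold tribPos
  split_ifs at * <;> omega

/-- Every position lies in the image of exactly one letter under `0 ↦ 01`, `1 ↦ 02`, `2 ↦ 0`. -/
theorem exists_tribPos (n : ℕ) :
    ∃ m, n = tribPos m ∨ (n = tribPos m + 1 ∧ trib m < 2) := by
  induction n with
  | zero => exact ⟨0, Or.inl (by simp [tribPos, tribCount_zero])⟩
  | succ n ih =>
    obtain ⟨m, h | ⟨h, ht⟩⟩ := ih
    · by_cases ht : trib m < 2
      · exact ⟨m, Or.inr ⟨by omega, ht⟩⟩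
      · refine ⟨m + 1, Or.inl ?_⟩
        have := trib_le_two m
        rw [tribPos_succ, if_pos (by omega)]
        omega
    · refine ⟨m + 1, Or.inl ?_⟩
      rw [tribPos_succ, if_neg (by omega)]
      omega

theorem exists_eq_tribPos {n : ℕ} (h : trib n = 0) : ∃ m, n = tribPos m := by
  obtain ⟨m, hm | ⟨hm, ht⟩⟩ := exists_tribPos n
  · exact ⟨m, hm⟩
  · have := trib_tribPos_add_one ht
    rw [← hm] at this
    omega

theorem exists_eq_tribPos_add_one {n : ℕ} (h : trib n ≠ 0) :
    ∃ m, n = tribPos m + 1 ∧ trib n = trib m + 1 := by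
  obtain ⟨m, hm | ⟨hm, ht⟩⟩ := exists_tribPos n
  · exact absurd (hm ▸ trib_tribPos m) h
  · exact ⟨m, hm, hm ▸ trib_tribPos_add_one ht⟩

/-- The possible letters at `n`, `k`, `k + 1` and `k + 2`, where `k = n + tribPos n`,
together with the letter counts of the prefix of length `k`. -/
def TribState (n k : ℕ) : Prop :=
  (tribCount 0 k = n + tribCount 0 n ∧ tribCount 1 k + 1 = tribCount 0 n + tribCount 1 n ∧
    ((trib n = 1 ∧ trib k = 1 ∧ trib (k + 1) = 0 ∧ trib (k + 2) = 1) ∨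
      (trib n = 2 ∧ trib k = 1 ∧ trib (k + 1) = 0 ∧ trib (k + 2) = 0))) ∨
  (tribCount 0 k = n + tribCount 0 n ∧ tribCount 1 k = tribCount 0 n + tribCount 1 n ∧
    ((trib n = 0 ∧ trib k = 0 ∧ trib (k + 1) = 0 ∧ trib (k + 2) = 1) ∨
      (trib n = 0 ∧ trib k = 0 ∧ trib (k + 1) = 1 ∧ trib (k + 2) = 0) ∨
      (trib n = 0 ∧ trib k = 0 ∧ trib (k + 1) = 2 ∧ trib (k + 2) = 0) ∨
      (trib n = 0 ∧ trib k = 1 ∧ trib (k + 1) = 0 ∧ trib (k + 2) = 0) ∨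
      (trib n = 1 ∧ trib k = 0 ∧ trib (k + 1) = 1 ∧ trib (k + 2) = 0) ∨
      (trib n = 1 ∧ trib k = 1 ∧ trib (k + 1) = 0 ∧ trib (k + 2) = 2) ∨
      (trib n = 1 ∧ trib k = 2 ∧ trib (k + 1) = 0 ∧ trib (k + 2) = 1) ∨
      (trib n = 2 ∧ trib k = 0 ∧ trib (k + 1) = 2 ∧ trib (k + 2) = 0) ∨
      (trib n = 2 ∧ trib k = 2 ∧ trib (k + 1) = 0 ∧ trib (k + 2) = 1))) ∨
  (tribCount 0 k = n + tribCount 0 n + 1 ∧ tribCount 1 k = tribCount 0 n + tribCount 1 n ∧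
    trib n = 0 ∧ trib k = 2 ∧ trib (k + 1) = 0 ∧ trib (k + 2) = 1)

theorem tribState_zero : TribState 0 0 := by
  simp [TribState, tribCount_zero, trib, tribRep, tribSucc]

/-- The block of letters produced by the letter at `j`. -/
theorem trib_block (j : ℕ) :
    (trib (tribPos j) = 0 ∧ tribCount 0 (tribPos j) = j ∧
      tribCount 1 (tribPos j) = tribCount 0 j) ∧
    (tribCount 0 (tribPos j + 1) = j + 1 ∧ tribCount 1 (tribPos j + 1) = tribCount 0 j) ∧
    ((trib j = 0 ∧ trib (tribPos j + 1) = 1 ∧ tribPos (j + 1) = tribPos j + 2) ∨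
      (trib j = 1 ∧ trib (tribPos j + 1) = 2 ∧ tribPos (j + 1) = tribPos j + 2) ∨
      (trib j = 2 ∧ trib (tribPos j + 1) = 0 ∧ tribPos (j + 1) = tribPos j + 1)) := by
  have h0 := trib_tribPos j
  refine ⟨⟨h0, tribCount_zero_tribPos j, tribCount_one_tribPos j⟩, ⟨?_, ?_⟩, ?_⟩
  · rw [tribCount_succ, tribCount_zero_tribPos, if_pos h0]
  · rw [tribCount_succ, tribCount_one_tribPos, if_neg (by omega), add_zero]
  · have hp := tribPos_succ j
    have hl := trib_le_two j
    have hc : trib j = 0 ∨ trib j = 1 ∨ trib j = 2 := by omega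
    rcases hc with h | h | h
    · exact Or.inl ⟨h, by rw [trib_tribPos_add_one (by omega), h], by simpa [h] using hp⟩
    · exact Or.inr (Or.inl ⟨h, by rw [trib_tribPos_add_one (by omega), h], by simpa [h] using hp⟩)
    · have hp' : tribPos (j + 1) = tribPos j + 1 := by simpa [h] using hp
      exact Or.inr (Or.inr ⟨h, hp' ▸ trib_tribPos (j + 1), hp'⟩)

theorem lt_tribPos {n : ℕ} (h : 1 ≤ n) : n < tribPos n := by
  induction n, h using Nat.le_induction with
  | base =>
    have h0 : tribPos 0 = 0 := by simp [tribPos, tribCount_zero]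
    have := trib_tribPos 0
    rw [h0] at this
    rw [tribPos_succ, this, if_neg (by norm_num)]
    omega
  | succ n _ ih =>
    rw [tribPos_succ]
    split_ifs <;> omega

theorem tribState_tribPos {m : ℕ} (h : TribState m (m + tribPos m)) :
    TribState (tribPos m) (tribPos m + tribPos (tribPos m)) := by
  obtain ⟨k, hk⟩ : ∃ k, k = m + tribPos m := ⟨_, rfl⟩
  obtain ⟨k', hk'⟩ : ∃ k', k' = tribPos m + tribPos (tribPos m) := ⟨_, rfl⟩
  rw [← hk] at h
  rw [← hk']
  have bm := trib_block m
  have bk := trib_block k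
  have bk1 := trib_block (k + 1)
  have bk' : trib k ≠ 2 → trib (tribPos k + 2) = 0 := fun h0 => by
    have := trib_tribPos (k + 1)
    rwa [tribPos_succ, if_neg h0] at this
  have e1 : tribPos m = m + tribCount 0 m + tribCount 1 m := rfl
  have e2 : tribPos (tribPos m) = tribPos m + m + tribCount 0 m := by
    conv_lhs => rw [tribPos]
    omega
  have e3 : tribPos k = k + tribCount 0 k + tribCount 1 k := rfl
  have ek := tribCount_succ 0 k
  rcases h with h | h | h
  · have : k' = tribPos k + 1 := by omega
    subst this
    clear hk'
    unfold TribState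
    grind
  · have : k' = tribPos k := by omega
    subst this
    clear hk'
    unfold TribState
    rcases h with ⟨h0, h1, h | h | h | h | h | h | h | h | h⟩ <;> grind
  · obtain ⟨l, rfl, hl⟩ := exists_eq_tribPos_add_one (n := k) (by omega)
    have bl := trib_block l
    have bpl := trib_block (tribPos l)
    have : k' = tribPos (tribPos l) + 1 := by omega
    have hk1 : tribPos (tribPos l) + 2 = tribPos (tribPos l + 1) := by omega
    have hk2 : tribPos (tribPos l) + 3 = tribPos (tribPos l + 1 + 1) := by omega
    have z1 := hk1 ▸ trib_tribPos (tribPos l + 1)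
    have z2 := hk2 ▸ trib_tribPos (tribPos l + 1 + 1)
    subst this
    clear hk'
    unfold TribState
    grind

set_option maxHeartbeats 1000000 in
theorem tribState_tribPos_add_one {m : ℕ} (hm : trib m < 2) (h : TribState m (m + tribPos m)) :
    TribState (tribPos m + 1) (tribPos m + 1 + tribPos (tribPos m + 1)) := by
  obtain ⟨k, hk⟩ : ∃ k, k = m + tribPos m := ⟨_, rfl⟩
  obtain ⟨k', hk'⟩ : ∃ k', k' = tribPos m + 1 + tribPos (tribPos m + 1) := ⟨_, rfl⟩
  rw [← hk] at h
  rw [← hk']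
  have bm := trib_block m
  have bk := trib_block k
  have bk1 := trib_block (k + 1)
  have bk2 := trib_block (k + 2)
  have bk3 := trib_tribPos (k + 3)
  have e1 : tribPos m = m + tribCount 0 m + tribCount 1 m := rfl
  have e2 : tribPos (tribPos m + 1) = tribPos m + m + tribCount 0 m + 2 := by
    conv_lhs => rw [tribPos]
    omega
  have e3 : tribPos k = k + tribCount 0 k + tribCount 1 k := rfl
  have ek := tribCount_succ 0 k
  have ek1 := tribCount_succ 0 (k + 1)
  have bk' : trib (k + 2) ≠ 2 → trib (tribPos (k + 2) + 2) = 0 := fun h0 => by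
    have := trib_tribPos (k + 2 + 1)
    rwa [tribPos_succ (k + 2), if_neg h0] at this
  simp only [add_assoc, Nat.reduceAdd] at bk1 bk2 ek1
  rcases h with h | h | h
  · have : k' = tribPos (k + 2) := by omega
    subst this
    clear hk'
    unfold TribState
    rcases h with ⟨h0, h1, h | h⟩ <;>
      obtain ⟨a, b, c, d⟩ := h <;>
      simp [a, b, c, d] at bm bk bk1 bk2 <;>
      grind
  · by_cases hk2 : trib k = 2
    · have : k' = tribPos (k + 2) := by omega
      subst this
      clear hk'
      unfold TribState
      rcases h with ⟨h0, h1, h | h | h | h | h | h | h | h | h⟩ <;>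
      obtain ⟨a, b, c, d⟩ := h <;>
      simp [a, b, c, d] at bm bk bk1 bk2 <;>
      grind
    · have : k' = tribPos (k + 1) + 1 := by omega
      subst this
      clear hk'
      unfold TribState
      rcases h with ⟨h0, h1, h | h | h | h | h | h | h | h | h⟩ <;>
      obtain ⟨a, b, c, d⟩ := h <;>
      simp [a, b, c, d] at bm bk bk1 bk2 <;>
      grind
  · have : k' = tribPos (k + 1) + 1 := by omega
    subst this
    clear hk'
    unfold TribState
    obtain ⟨h0, h1, a, b, c, d⟩ := h
    simp [a, b, c, d] at bm bk bk1 bk2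
    grind

theorem tribState (n : ℕ) : TribState n (n + tribPos n) := by
  induction n using Nat.strong_induction_on with
  | _ n ih =>
    rcases Nat.eq_zero_or_pos n with rfl | hn
    · simpa [tribPos, tribCount_zero] using tribState_zero
    · obtain ⟨m, rfl | ⟨rfl, hm⟩⟩ := exists_tribPos n
      · refine tribState_tribPos (ih m (lt_tribPos ?_))
        by_contra h0
        simp [show m = 0 by omega, tribPos, tribCount_zero] at hn
      · refine tribState_tribPos_add_one hm (ih m ?_)
        unfold tribPos
        omega

theorem mex_eq {S : Set ℕ} {v : ℕ} (hv : v ∉ S) (h : ∀ u < v, u ∈ S) : mex S = v :=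
  le_antisymm (Nat.sInf_le hv) (not_lt.1 fun hlt => Nat.sInf_mem (s := {m | m ∉ S}) ⟨v, hv⟩ (h _ hlt))

theorem trib_eq_one_iff {n : ℕ} : trib n = 1 ↔ ∃ i, n = tribPos (tribPos i) + 1 := by
  constructor
  · intro h
    obtain ⟨m, hm, ht⟩ := exists_eq_tribPos_add_one (n := n) (by omega)
    obtain ⟨i, rfl⟩ := exists_eq_tribPos (n := m) (by omega)
    exact ⟨i, hm⟩
  · rintro ⟨i, rfl⟩
    have := trib_tribPos i
    rw [trib_tribPos_add_one (by omega), this]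

/-- The sequence `α`. -/
def qdeeA : ℕ → ℕ
  | 0 => 0
  | n + 1 => n + 1 + tribCount 0 n

/-- The sequence `β - α`. -/
def qdeeD : ℕ → ℕ
  | 0 => 0
  | n + 1 => n + 1 + tribCount 1 n

theorem qdeeA_strictMono : StrictMono qdeeA := by
  refine strictMono_nat_of_lt_succ fun n => ?_
  cases n with
  | zero => simp [qdeeA]
  | succ n =>
    have := tribCount_succ 0 n
    simp only [qdeeA]
    omega

theorem qdeeD_strictMono : StrictMono qdeeD := by
  refine strictMono_nat_of_lt_succ fun n => ?_
  cases n with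
  | zero => simp [qdeeD]
  | succ n =>
    have := tribCount_succ 1 n
    simp only [qdeeD]
    omega

theorem StrictMono.ne_of_lt_of_lt_succ {f : ℕ → ℕ} (hf : StrictMono f) {n v : ℕ} (h : f n < v)
    (h' : v < f (n + 1)) (m : ℕ) : f m ≠ v := by
  rintro rfl
  have := hf.lt_iff_lt.1 h
  have := hf.lt_iff_lt.1 h'
  omega

/-- The gap of `α` after the `n`-th letter `0` is filled by `β`. -/
theorem qdeeA_tribPos (n : ℕ) :
    qdeeA (tribPos n + 1) + 1 = qdeeA (n + 1) + qdeeD (n + 1) ∧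
      qdeeA (tribPos n + 2) = qdeeA (tribPos n + 1) + 2 := by
  have := trib_block n
  simp only [qdeeA, qdeeD]
  have : tribPos n = n + tribCount 0 n + tribCount 1 n := rfl
  omega

/-- The gap of `β - α` after the `n`-th letter `1` is filled by `β + α`. -/
theorem qdeeD_tribPos (n : ℕ) :
    qdeeD (tribPos (tribPos n) + 2) + 1 = 2 * qdeeA (n + 1) + qdeeD (n + 1) ∧
      qdeeD (tribPos (tribPos n) + 3) = qdeeD (tribPos (tribPos n) + 2) + 2 := by
  have h1 := trib_block n
  have h2 := trib_block (tribPos n)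
  have h3 := tribCount_succ 1 (tribPos (tribPos n) + 1)
  have e1 : tribPos n = n + tribCount 0 n + tribCount 1 n := rfl
  have e2 : tribPos (tribPos n) = tribPos n + n + tribCount 0 n := by
    conv_lhs => rw [tribPos]
    omega
  rw [trib_eq_one_iff.2 ⟨n, rfl⟩] at h3
  simp only [qdeeA, qdeeD]
  simp only [add_assoc, Nat.reduceAdd, if_true] at h3 h2 ⊢
  omega

theorem qdeeA_ne (m n : ℕ) : qdeeA m ≠ qdeeA (n + 1) + qdeeD (n + 1) :=
  qdeeA_strictMono.ne_of_lt_of_lt_succ (n := tribPos n + 1)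
    (by have := qdeeA_tribPos n; omega) (show _ < qdeeA (tribPos n + 2) by have := qdeeA_tribPos n; omega) m

theorem qdeeD_ne (m n : ℕ) : qdeeD m ≠ 2 * qdeeA (n + 1) + qdeeD (n + 1) :=
  qdeeD_strictMono.ne_of_lt_of_lt_succ (n := tribPos (tribPos n) + 2)
    (by have := qdeeD_tribPos n; omega)
    (show _ < qdeeD (tribPos (tribPos n) + 3) by have := qdeeD_tribPos n; omega) m

theorem exists_of_lt_qdeeA {n u : ℕ} (h : u < qdeeA (n + 1)) :
    ∃ i ≤ n, u = qdeeA i ∨ u = qdeeA i + qdeeD i := by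
  induction n with
  | zero =>
    refine ⟨0, le_rfl, Or.inl ?_⟩
    simp only [qdeeA, tribCount_zero] at h ⊢
    omega
  | succ n ih =>
    have hc := tribCount_succ 0 n
    by_cases hlt : u < qdeeA (n + 1)
    · obtain ⟨i, hi, hu⟩ := ih hlt
      exact ⟨i, by omega, hu⟩
    by_cases he : u = qdeeA (n + 1)
    · exact ⟨n + 1, le_rfl, Or.inl he⟩
    have ht : trib n = 0 := by
      by_contra ht
      rw [if_neg ht] at hc
      simp only [qdeeA] at *
      omega
    obtain ⟨i, rfl⟩ := exists_eq_tribPos ht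
    have hi := qdeeA_tribPos i
    refine ⟨i + 1, ?_, Or.inr ?_⟩
    · unfold tribPos
      omega
    · rw [show tribPos i + 1 + 1 = tribPos i + 2 from rfl] at h
      omega

theorem exists_of_lt_qdeeD {n u : ℕ} (h : u < qdeeD (n + 1)) :
    ∃ i ≤ n, u = qdeeD i ∨ u = 2 * qdeeA i + qdeeD i := by
  induction n with
  | zero =>
    refine ⟨0, le_rfl, Or.inl ?_⟩
    simp only [qdeeD, tribCount_zero] at h ⊢
    omega
  | succ n ih =>
    have hc := tribCount_succ 1 n
    by_cases hlt : u < qdeeD (n + 1)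
    · obtain ⟨i, hi, hu⟩ := ih hlt
      exact ⟨i, by omega, hu⟩
    by_cases he : u = qdeeD (n + 1)
    · exact ⟨n + 1, le_rfl, Or.inl he⟩
    have ht : trib n = 1 := by
      by_contra ht
      rw [if_neg ht] at hc
      simp only [qdeeD] at *
      omega
    obtain ⟨i, rfl⟩ := trib_eq_one_iff.1 ht
    have hi := qdeeD_tribPos i
    refine ⟨i + 1, ?_, Or.inr ?_⟩
    · simp only [tribPos]
      omega
    · simp only [add_assoc, Nat.reduceAdd] at *
      omega

theorem qdee1_eq (n : ℕ) : qdee1 n = (qdeeA n, qdeeA n + qdeeD n) := by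
  induction n using Nat.strong_induction_on with
  | _ n ih =>
    cases n with
    | zero => simp [qdee1, qdeeA, qdeeD]
    | succ n =>
      have hq : ∀ i ≤ n, qdee1 i = (qdeeA i, qdeeA i + qdeeD i) := fun i hi => ih i (by omega)
      have hA : mex ({m | ∃ i, ∃ _ : i ≤ n, m = (qdee1 i).1} ∪
          {m | ∃ i, ∃ _ : i ≤ n, m = (qdee1 i).2}) = qdeeA (n + 1) := by
        refine mex_eq ?_ fun u hu => ?_
        · rintro (⟨i, hi, h⟩ | ⟨i, hi, h⟩) <;> rw [hq i hi] at h
          · exact (qdeeA_strictMono (Nat.lt_succ_of_le hi)).ne' h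
          · cases i with
            | zero => simp [qdeeA, qdeeD] at h
            | succ i => exact qdeeA_ne _ _ h
        · obtain ⟨i, hi, h | h⟩ := exists_of_lt_qdeeA hu
          · exact Or.inl ⟨i, hi, by rw [hq i hi, h]⟩
          · exact Or.inr ⟨i, hi, by rw [hq i hi, h]⟩
      have hD : mex ({m | ∃ i, ∃ _ : i ≤ n, m = (qdee1 i).2 - (qdee1 i).1} ∪
          {m | ∃ i, ∃ _ : i ≤ n, m = (qdee1 i).2 + (qdee1 i).1}) = qdeeD (n + 1) := by
        refine mex_eq ?_ fun u hu => ?_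
        · rintro (⟨i, hi, h⟩ | ⟨i, hi, h⟩) <;> rw [hq i hi] at h
          · have := qdeeD_strictMono (Nat.lt_succ_of_le hi)
            simp only [Nat.succ_eq_add_one] at *
            omega
          · cases i with
            | zero => simp [qdeeA, qdeeD] at h
            | succ i =>
              refine qdeeD_ne _ i (h.trans ?_)
              ring
        · obtain ⟨i, hi, h | h⟩ := exists_of_lt_qdeeD hu
          · exact Or.inl ⟨i, hi, by rw [hq i hi, h]; simp⟩
          · exact Or.inr ⟨i, hi, by rw [hq i hi, h]; ring⟩
      rw [qdee1]
      simp only [hA, hD]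

/-- For every `n ≥ 1`, either `α_{βₙ} = αₙ + βₙ` or `α_{βₙ} = αₙ + βₙ − 1`. -/
theorem qdee1_coordinate_sums (n : ℕ) (hn : 1 ≤ n) :
    (qdee1 ((qdee1 n).2)).1 = (qdee1 n).1 + (qdee1 n).2 ∨
    (qdee1 ((qdee1 n).2)).1 = (qdee1 n).1 + (qdee1 n).2 - 1 := by
  obtain ⟨n, rfl⟩ : ∃ m, n = m + 1 := ⟨n - 1, by omega⟩
  have hs := tribState n
  have hc := tribCount_succ 0 (n + tribPos n)
  have hp : tribPos n = n + tribCount 0 n + tribCount 1 n := rfl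
  have hb : qdeeA (n + 1) + qdeeD (n + 1) = n + tribPos n + 1 + 1 := by
    simp only [qdeeA, qdeeD]
    omega
  simp only [qdee1_eq, hb]
  simp only [qdeeA]
  unfold TribState at hs
  split_ifs at hc <;> omega
end
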